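/- Let L0 be a closed densely defined symmetric positive definite operator in a complex Hilbert space H, and L a positive definite self-adjoint extension of L0 with bounded everywhere-defined inverse L⁻¹. Let D be a nonzero closed subspace of H such that D ⊆ (Ker L0*)ᗮ and L⁻¹ D ⊆ D. Then L⁻¹ D is dense in D, and the restriction of L0 to L⁻¹ D, regarded as a densely defined operator in the Hilbert space D, is self-adjoint. In other words, L0 has a self-adjoint part in D, so L0 is not completely non-self-adjoint (this is the sufficiency half of Theorem 1: if the defect subspace D of the dynamical system with boundary control is nonzero, L0 fails to be completely non-self-adjoint). -/

import Mathlib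

local notation "⟪" x ", " y "⟫" => @inner ℂ _ _ x y

/-- The kernel of a partially defined linear operator, as a submodule of the ambient space. -/
def pker {H : Type*} [NormedAddCommGroup H] [InnerProductSpace ℂ H]
    (T : H →ₗ.[ℂ] H) : Submodule ℂ H :=
  (LinearMap.ker T.toFun).map T.domain.subtype

variable {H : Type*} [NormedAddCommGroup H] [InnerProductSpace ℂ H]


/-- The domain of the part of `L0` in a subspace `N`:
elements of `N` that lie in `Dom L0` and are mapped by `L0` into `N`. -/
def partDomain (L0 : H →ₗ.[ℂ] H) (N : Submodule ℂ H) : Submodule ℂ N where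
  carrier := {x : N | ∃ hx : (x : H) ∈ L0.domain, L0 ⟨(x : H), hx⟩ ∈ N}
  zero_mem' := by
    refine ⟨L0.domain.zero_mem, ?_⟩
    have h0 : (⟨((0 : N) : H), L0.domain.zero_mem⟩ : L0.domain) = 0 := by
      ext; rfl
    rw [h0, L0.map_zero]
    exact N.zero_mem
  add_mem' := by
    rintro x y ⟨hx, hLx⟩ ⟨hy, hLy⟩
    refine ⟨L0.domain.add_mem hx hy, ?_⟩
    have h : (⟨(((x + y : N)) : H), L0.domain.add_mem hx hy⟩ : L0.domain)
        = ⟨(x : H), hx⟩ + ⟨(y : H), hy⟩ := by ext; rfl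
    rw [h, L0.map_add]
    exact N.add_mem hLx hLy
  smul_mem' := by
    rintro c x ⟨hx, hLx⟩
    refine ⟨L0.domain.smul_mem c hx, ?_⟩
    have h : (⟨(((c • x : N)) : H), L0.domain.smul_mem c hx⟩ : L0.domain)
        = c • (⟨(x : H), hx⟩ : L0.domain) := by ext; rfl
    rw [h, L0.map_smul]
    exact N.smul_mem c hLx

/-- The part of `L0` in a subspace `N`, as a partially defined operator in `N`. -/
noncomputable def restrictPart (L0 : H →ₗ.[ℂ] H) (N : Submodule ℂ H) : N →ₗ.[ℂ] N where
  domain := partDomain L0 N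
  toFun :=
    { toFun := fun x => ⟨L0 ⟨((x : N) : H), x.2.choose⟩, x.2.choose_spec⟩
      map_add' := by
        rintro x y
        ext
        show (L0 _ : H) = ((⟨L0 ⟨((x : N) : H), x.2.choose⟩, x.2.choose_spec⟩ : N)
          + (⟨L0 ⟨((y : N) : H), y.2.choose⟩, y.2.choose_spec⟩ : N) : H)
        have h : (⟨(((x + y : ↥(partDomain L0 N)) : N) : H), (x + y).2.choose⟩ : L0.domain)
            = ⟨((x : N) : H), x.2.choose⟩ + ⟨((y : N) : H), y.2.choose⟩ := by
          ext; rfl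
        rw [h, L0.map_add]
      map_smul' := by
        rintro c x
        ext
        show (L0 _ : H) = (c • (⟨L0 ⟨((x : N) : H), x.2.choose⟩, x.2.choose_spec⟩ : N) : H)
        have h : (⟨(((c • x : ↥(partDomain L0 N)) : N) : H), (c • x).2.choose⟩ : L0.domain)
            = c • (⟨((x : N) : H), x.2.choose⟩ : L0.domain) := by
          ext; rfl
        rw [h, L0.map_smul] }

/-- An operator whose graph is the flipped graph of a symmetric bounded operator `A`
(so that `A` is its inverse) is densely defined. -/
theorem dense_domain_of_mem_graph_iff {E : Type*} [NormedAddCommGroup E] [InnerProductSpace ℂ E]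
    [CompleteSpace E] {T : E →ₗ.[ℂ] E} {A : E →L[ℂ] E} (hA : A.toLinearMap.IsSymmetric)
    (hT : ∀ x y, (x, y) ∈ T.graph ↔ A y = x) : Dense (T.domain : Set E) := by
  rw [Submodule.dense_iff_topologicalClosure_eq_top, Submodule.topologicalClosure_eq_top_iff,
    Submodule.eq_bot_iff]
  intro z hz
  have hAz : A z = 0 := by
    refine ext_inner_left ℂ fun y => ?_
    have hy : A y ∈ T.domain := T.mem_domain_of_mem_graph ((hT (A y) y).2 rfl)
    rw [inner_zero_right, ← (Submodule.mem_orthogonal _ _).1 hz _ hy]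
    exact (hA y z).symm
  exact T.graph_fst_eq_zero_snd ((hT 0 z).2 hAz) rfl

/-- An operator whose graph is the flipped graph of a symmetric bounded operator `A`
(so that `A` is its inverse) is self-adjoint. -/
theorem adjoint_eq_self_of_mem_graph_iff {E : Type*} [NormedAddCommGroup E]
    [InnerProductSpace ℂ E] [CompleteSpace E] {T : E →ₗ.[ℂ] E} {A : E →L[ℂ] E}
    (hA : A.toLinearMap.IsSymmetric) (hT : ∀ x y, (x, y) ∈ T.graph ↔ A y = x) :
    T.adjoint = T := by
  apply LinearPMap.eq_of_eq_graph
  rw [LinearPMap.adjoint_graph_eq_graph_adjoint (dense_domain_of_mem_graph_iff hA hT)]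
  ext ⟨u, v⟩
  rw [Submodule.mem_adjoint_iff, hT]
  have hAv : ∀ y, ⟪A y, v⟫ = ⟪y, A v⟫ := fun y => hA y v
  simp only [hT, sub_eq_zero]
  constructor
  · exact fun h => ext_inner_left ℂ fun y => by rw [h _ y rfl, hAv]
  · rintro rfl _ y rfl
    exact (hAv y).symm

/-- Pairs in the graph of the part of `L0` in `N` are the pairs of the graph of `L0` in `N`. -/
theorem mem_graph_restrictPart_iff {L0 : H →ₗ.[ℂ] H} {N : Submodule ℂ H} (x y : N) :
    (x, y) ∈ (restrictPart L0 N).graph ↔ ((x : H), (y : H)) ∈ L0.graph := by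
  simp only [LinearPMap.mem_graph_iff]
  constructor
  · rintro ⟨z, rfl, rfl⟩
    exact ⟨⟨_, z.2.choose⟩, rfl, rfl⟩
  · rintro ⟨⟨z, hz⟩, hzx, hzy⟩
    subst hzx
    exact ⟨⟨x, hz, hzy ▸ y.2⟩, rfl, Subtype.ext hzy⟩

/-- Vectors orthogonal to the range of a densely defined operator lie in the kernel of its
adjoint. -/
theorem mem_pker_adjoint_of_inner_eq_zero [CompleteSpace H] {T : H →ₗ.[ℂ] H}
    (hT : Dense (T.domain : Set H)) {z : H} (hz : ∀ x : T.domain, ⟪z, T x⟫ = 0) :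
    z ∈ pker T.adjoint := by
  have h0 : ∀ x : T.domain, ⟪(0 : H), (x : H)⟫ = ⟪z, T x⟫ := fun x => by
    rw [inner_zero_left, hz]
  exact ⟨⟨z, LinearPMap.mem_adjoint_domain_of_exists z ⟨0, h0⟩⟩,
    LinearPMap.adjoint_apply_eq hT _ h0, rfl⟩

/-- If a densely defined closed operator `T` has a bounded left inverse `B`, then every vector
orthogonal to the kernel of the adjoint lies in the range of `T`, with preimage given by `B`. -/
theorem mem_graph_of_mem_orthogonal_pker_adjoint [CompleteSpace H] {T : H →ₗ.[ℂ] H}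
    (hT : Dense (T.domain : Set H)) (hclosed : T.IsClosed) {B : H →L[ℂ] H}
    (hB : ∀ x : T.domain, B (T x) = x) {y : H} (hy : y ∈ (pker T.adjoint)ᗮ) :
    (B y, y) ∈ T.graph := by
  let R : Submodule ℂ H := T.graph.comap (B.prod (ContinuousLinearMap.id ℂ H)).toLinearMap
  have hR : IsClosed (R : Set H) :=
    IsClosed.preimage (B.prod (ContinuousLinearMap.id ℂ H)).continuous hclosed
  have hRK : Rᗮ ≤ pker T.adjoint := fun z hz => by
    refine mem_pker_adjoint_of_inner_eq_zero hT fun x => ?_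
    refine (Submodule.mem_orthogonal' _ _).1 hz _ ?_
    change (B (T x), T x) ∈ T.graph
    rw [hB]
    exact T.mem_graph x
  have hyR : y ∈ Rᗮᗮ := Submodule.orthogonal_le hRK hy
  rw [Submodule.orthogonal_orthogonal_eq_closure, hR.submodule_topologicalClosure_eq] at hyR
  exact hyR

/-- Sufficiency half of Theorem 1: if `D` is a nonzero closed subspace with
`D ⊆ (Ker L0*)ᗮ` and `L⁻¹ D ⊆ D`, then `L0` has a self-adjoint part in `D`
(with domain `L⁻¹ D`, which is dense in `D`); so `L0` is not completely
non-self-adjoint. -/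
theorem statement11 {H : Type*} [NormedAddCommGroup H] [InnerProductSpace ℂ H] [CompleteSpace H]
    (L0 : H →ₗ.[ℂ] H)
    (hdense : Dense (L0.domain : Set H))
    (hclosed : L0.IsClosed)
    (hsym : ∀ u v : L0.domain, ⟪L0 u, (v : H)⟫ = ⟪(u : H), L0 v⟫)
    (κ : ℝ) (hκ : 0 < κ)
    (hpos : ∀ y : L0.domain, κ * ‖(y : H)‖ ^ 2 ≤ (⟪L0 y, (y : H)⟫).re)
    -- `L` is a self-adjoint extension of `L0`, positive definite, bijective onto `H`
    (L : H →ₗ.[ℂ] H) (hL0L : L0 ≤ L) (hLsa : L.adjoint = L)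
    (hLpos : ∀ y : L.domain, κ * ‖(y : H)‖ ^ 2 ≤ (⟪L y, (y : H)⟫).re)
    -- `Linv` is the (bounded, everywhere-defined, self-adjoint) inverse of `L`
    (Linv : H →L[ℂ] H) (hLinvsa : IsSelfAdjoint Linv)
    (hinvl : ∀ x : L.domain, Linv (L x) = (x : H))
    (hinvmem : ∀ x : H, Linv x ∈ L.domain)
    (hinvr : ∀ x : H, L ⟨Linv x, hinvmem x⟩ = x)
    -- `D` is a nonzero closed subspace of `H` with `D ⊆ (Ker L0*)ᗮ` and `L⁻¹ D ⊆ D`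
    (D : Submodule ℂ H) [CompleteSpace D] (hD : D ≠ ⊥)
    (hDK : D ≤ (pker L0.adjoint)ᗮ)
    (hDinv : ∀ x ∈ D, Linv x ∈ D) :
    -- the domain of the part of `L0` in `D` is exactly `L⁻¹ D` ...
    ((restrictPart L0 D).domain : Set D) = Subtype.val ⁻¹' (Linv '' (D : Set H)) ∧
    -- ... it is dense in `D` ...
    Dense ((restrictPart L0 D).domain : Set D) ∧
    -- ... and the part of `L0` in `D` is self-adjoint as an operator in `D`
    (restrictPart L0 D).adjoint = restrictPart L0 D := by
  have hB : ∀ x : L0.domain, Linv (L0 x) = x := fun x => by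
    rw [hL0L.2 (y := ⟨x, hL0L.1 x.2⟩) rfl, hinvl]
  let A : D →L[ℂ] D := Linv.restrict hDinv
  have hA : A.toLinearMap.IsSymmetric := fun x y => hLinvsa.isSymmetric x y
  have hgraph : ∀ x y : D, (x, y) ∈ (restrictPart L0 D).graph ↔ A y = x := by
    intro x y
    rw [mem_graph_restrictPart_iff, Subtype.ext_iff]
    change _ ↔ Linv y = x
    constructor
    · intro h
      obtain ⟨z, hzx, hzy⟩ := (LinearPMap.mem_graph_iff _).1 h
      rw [← show L0 z = y from hzy, hB]
      exact hzx
    · intro h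
      rw [← h]
      exact mem_graph_of_mem_orthogonal_pker_adjoint hdense hclosed hB (hDK y.2)
  refine ⟨?_, dense_domain_of_mem_graph_iff hA hgraph, adjoint_eq_self_of_mem_graph_iff hA hgraph⟩
  ext x
  rw [SetLike.mem_coe, LinearPMap.mem_domain_iff]
  simp only [hgraph]
  exact ⟨fun ⟨y, hy⟩ => ⟨y, y.2, congrArg Subtype.val hy⟩,
    fun ⟨y, hyD, hy⟩ => ⟨⟨y, hyD⟩, Subtype.ext hy⟩⟩
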